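/- For every ν ∈ ℤ^d, the function Φ_ν = L[Ψ_ν] satisfies the uniform bound sup_{x ∈ [0,1]^d} |L[Ψ_ν](x)| ≤ a₀ + β + ρ/(4π²). -/

import Mathlib

open Finset MeasureTheory

noncomputable def fourF (d : ℕ) (ν : Fin d → ℤ) (x : Fin d → ℝ) : ℂ :=
  Complex.exp (2 * (Real.pi : ℂ) * Complex.I * ∑ j, (ν j : ℂ) * (x j : ℂ))

noncomputable def pdv (d : ℕ) (k : Fin d) (f : (Fin d → ℝ) → ℂ) : (Fin d → ℝ) → ℂ :=
  fun x => fderiv ℝ f x (Pi.single k 1)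

noncomputable def lapl (d : ℕ) (f : (Fin d → ℝ) → ℂ) : (Fin d → ℝ) → ℂ :=
  fun x => ∑ k, pdv d k (pdv d k f) x

noncomputable def sqL2 (d : ℕ) (f : (Fin d → ℝ) → ℂ) : ℝ :=
  ∫ x in Set.Icc (0 : Fin d → ℝ) 1, ‖f x‖ ^ 2

noncomputable def sqH2 (d : ℕ) (f : (Fin d → ℝ) → ℂ) : ℝ :=
  sqL2 d f + (∑ k : Fin d, sqL2 d (pdv d k f)) +
    ∑ k : Fin d, ∑ l : Fin d, sqL2 d (pdv d k (pdv d l f))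

noncomputable def enorm2Z (d : ℕ) (ν : Fin d → ℤ) : ℝ := ∑ j, ((ν j : ℝ)) ^ 2

noncomputable def dotZR (d : ℕ) (τ ν : Fin d → ℤ) : ℝ := ∑ j, (τ j : ℝ) * (ν j : ℝ)

noncomputable def Lop (d : ℕ) (a : (Fin d → ℝ) → ℂ) (ρ : ℝ) (u : (Fin d → ℝ) → ℂ) :
    (Fin d → ℝ) → ℂ :=
  fun x => -(∑ k, pdv d k (fun y => a y * pdv d k u y) x) + (ρ : ℂ) * u x

noncomputable def GramM (d : ℕ) (a : (Fin d → ℝ) → ℂ) (ρ : ℝ)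
    (Ψ : (Fin d → ℤ) → (Fin d → ℝ) → ℂ) (ν μ : Fin d → ℤ) : ℂ :=
  ∫ x in Set.Icc (0 : Fin d → ℝ) 1,
    Lop d a ρ (Ψ ν) x * (starRingEnd ℂ) (Lop d a ρ (Ψ μ) x)

theorem hasFDerivAt_fourF (d : ℕ) (ν : Fin d → ℤ) (x : Fin d → ℝ) :
    HasFDerivAt (fourF d ν)
      (fourF d ν x • (2 * (Real.pi : ℂ) * Complex.I) •
        ∑ j, (ν j : ℂ) • (Complex.ofRealCLM ∘L ContinuousLinearMap.proj (R := ℝ) j)) x := by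
  have h : ∀ j ∈ (Finset.univ : Finset (Fin d)),
      HasFDerivAt (fun y : Fin d → ℝ => (ν j : ℂ) * (y j : ℂ))
        ((ν j : ℂ) • (Complex.ofRealCLM ∘L ContinuousLinearMap.proj (R := ℝ) j)) x := by
    intro j _
    have hj : HasFDerivAt (fun y : Fin d → ℝ => (y j : ℂ))
        (Complex.ofRealCLM ∘L ContinuousLinearMap.proj (R := ℝ) j) x :=
      Complex.ofRealCLM.hasFDerivAt.comp x (hasFDerivAt_apply j x)
    exact hj.const_mul (ν j : ℂ)
  exact ((HasFDerivAt.fun_sum h).const_mul (2 * (Real.pi : ℂ) * Complex.I)).cexp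

theorem pdv_fourF (d : ℕ) (k : Fin d) (ν : Fin d → ℤ) (x : Fin d → ℝ) :
    pdv d k (fourF d ν) x = 2 * (Real.pi : ℂ) * Complex.I * (ν k : ℂ) * fourF d ν x := by
  unfold pdv
  rw [(hasFDerivAt_fourF d ν x).fderiv]
  have h : ∑ j, (ν j : ℂ) * (((Pi.single k (1 : ℝ) : Fin d → ℝ) j : ℝ) : ℂ) = (ν k : ℂ) := by
    rw [Finset.sum_eq_single k] <;> simp +contextual
  simp only [FunLike.coe_smul, Pi.smul_apply, _root_.sum_apply,
    ContinuousLinearMap.comp_apply, ContinuousLinearMap.proj_apply, Complex.ofRealCLM_apply,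
    smul_eq_mul, h]
  ring

theorem pdv_const_mul_fourF (d : ℕ) (k : Fin d) (c : ℂ) (ν : Fin d → ℤ) (x : Fin d → ℝ) :
    pdv d k (fun y => c * fourF d ν y) x =
      c * (2 * (Real.pi : ℂ) * Complex.I * (ν k : ℂ) * fourF d ν x) := by
  rw [← pdv_fourF]
  unfold pdv
  rw [fderiv_const_mul (hasFDerivAt_fourF d ν x).differentiableAt]
  rfl

theorem pdv_sum_fourF (d : ℕ) (k : Fin d) {ι : Type*} (s : Finset ι) (c : ι → ℂ)
    (m : ι → Fin d → ℤ) (x : Fin d → ℝ) :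
    pdv d k (fun y => ∑ i ∈ s, c i * fourF d (m i) y) x =
      ∑ i ∈ s, c i * (2 * (Real.pi : ℂ) * Complex.I * (m i k : ℂ) * fourF d (m i) x) := by
  simp_rw [← pdv_const_mul_fourF]
  unfold pdv
  rw [fderiv_fun_sum fun i _ => (hasFDerivAt_fourF d (m i) x).differentiableAt.const_mul (c i)]
  simp

theorem fourF_add (d : ℕ) (ν μ : Fin d → ℤ) (x : Fin d → ℝ) :
    fourF d (ν + μ) x = fourF d ν x * fourF d μ x := by
  unfold fourF
  rw [← Complex.exp_add, ← mul_add, ← Finset.sum_add_distrib]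
  congr 2
  refine Finset.sum_congr rfl fun j _ => ?_
  simp only [Pi.add_apply, Int.cast_add]
  ring

theorem norm_fourF (d : ℕ) (ν : Fin d → ℤ) (x : Fin d → ℝ) : ‖fourF d ν x‖ = 1 := by
  have h : 2 * (Real.pi : ℂ) * Complex.I * ∑ j, (ν j : ℂ) * (x j : ℂ) =
      ((2 * Real.pi * ∑ j, (ν j : ℝ) * x j : ℝ) : ℂ) * Complex.I := by
    push_cast
    ring
  rw [fourF, h, Complex.norm_exp_ofReal_mul_I]

theorem enorm2Z_nonneg (d : ℕ) (ν : Fin d → ℤ) : 0 ≤ enorm2Z d ν :=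
  Finset.sum_nonneg fun _ _ => sq_nonneg _

theorem one_le_enorm2Z (d : ℕ) {ν : Fin d → ℤ} (hν : ν ≠ 0) : 1 ≤ enorm2Z d ν := by
  obtain ⟨j, hj⟩ := Function.ne_iff.mp hν
  have hj' : (1 : ℝ) ≤ (ν j : ℝ) ^ 2 := by
    have : 0 < ν j ^ 2 := sq_pos_of_ne_zero hj
    exact_mod_cast this
  exact hj'.trans
    (Finset.single_le_sum (f := fun j => (ν j : ℝ) ^ 2) (fun _ _ => sq_nonneg _)
      (Finset.mem_univ j))

theorem dotZR_sq_le (d : ℕ) (τ ν : Fin d → ℤ) :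
    dotZR d τ ν ^ 2 ≤ enorm2Z d τ * enorm2Z d ν :=
  Finset.sum_mul_sq_le_sq_mul_sq _ _ _

/-- The operator applied to a multiple of a Fourier mode, expanded in Fourier modes. -/
theorem Lop_const_mul_fourF (d : ℕ) (T : Finset (Fin d → ℤ)) (a₀ c : ℂ) (ρ : ℝ)
    (aC : (Fin d → ℤ) → ℂ) (ν : Fin d → ℤ) (x : Fin d → ℝ) :
    Lop d (fun y => a₀ + ∑ τ ∈ T, aC τ * fourF d τ y) ρ (fun y => c * fourF d ν y) x =
      c * ((4 * (Real.pi : ℂ) ^ 2 * (enorm2Z d ν : ℂ) * a₀ + ρ) * fourF d ν x +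
        ∑ τ ∈ T, 4 * (Real.pi : ℂ) ^ 2 * ((enorm2Z d ν + dotZR d τ ν : ℝ) : ℂ) * aC τ *
          fourF d (τ + ν) x) := by
  have hk : ∀ k : Fin d,
      pdv d k (fun y => (a₀ + ∑ τ ∈ T, aC τ * fourF d τ y) *
        pdv d k (fun y => c * fourF d ν y) y) x =
      -c * (4 * (Real.pi : ℂ) ^ 2 * (ν k : ℂ) ^ 2 * a₀ * fourF d ν x +
        ∑ τ ∈ T, 4 * (Real.pi : ℂ) ^ 2 * ((ν k : ℂ) ^ 2 + (τ k : ℂ) * (ν k : ℂ)) * aC τ *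
          fourF d (τ + ν) x) := by
    intro k
    have hfun : (fun y => (a₀ + ∑ τ ∈ T, aC τ * fourF d τ y) *
        pdv d k (fun y => c * fourF d ν y) y) =
        fun y => ∑ i ∈ Finset.insertNone T,
          (c * (2 * (Real.pi : ℂ) * Complex.I * (ν k : ℂ)) * i.elim a₀ aC) *
            fourF d (i.elim ν (· + ν)) y := by
      funext y
      rw [pdv_const_mul_fourF, Finset.sum_insertNone, add_mul, Finset.sum_mul]
      simp only [Option.elim_none, Option.elim_some, fourF_add]
      congr 1
      · ring
      · exact Finset.sum_congr rfl fun τ _ => by ring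
    rw [hfun, pdv_sum_fourF, Finset.sum_insertNone, mul_add, Finset.mul_sum]
    simp only [Option.elim_none, Option.elim_some, Pi.add_apply, Int.cast_add]
    congr 1
    · linear_combination (4 * c * (Real.pi : ℂ) ^ 2 * (ν k : ℂ) ^ 2 * a₀ * fourF d ν x) *
        Complex.I_sq
    · refine Finset.sum_congr rfl fun τ _ => ?_
      linear_combination (4 * c * (Real.pi : ℂ) ^ 2 * ((ν k : ℂ) ^ 2 + (τ k : ℂ) * (ν k : ℂ)) *
        aC τ * fourF d (τ + ν) x) * Complex.I_sq
  have hsum : ∀ τ : Fin d → ℤ, ((enorm2Z d ν + dotZR d τ ν : ℝ) : ℂ) =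
      ∑ k, ((ν k : ℂ) ^ 2 + (τ k : ℂ) * (ν k : ℂ)) := by
    intro τ
    rw [enorm2Z, dotZR, ← Finset.sum_add_distrib]
    push_cast
    rfl
  have hν : (enorm2Z d ν : ℂ) = ∑ k, (ν k : ℂ) ^ 2 := by
    rw [enorm2Z]
    push_cast
    rfl
  unfold Lop
  simp_rw [hk, hsum, hν]
  rw [← Finset.mul_sum, Finset.sum_add_distrib, Finset.sum_comm]
  simp_rw [← Finset.sum_mul, ← Finset.mul_sum]
  ring

theorem abs_enorm2Z_add_dotZR_le (d : ℕ) {τ : Fin d → ℤ} (hτ : τ ≠ 0) (ν : Fin d → ℤ) :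
    |enorm2Z d ν + dotZR d τ ν| ≤
      enorm2Z d ν * √(1 + 4 * Real.pi ^ 2 * enorm2Z d τ) := by
  have hD := dotZR_sq_le d τ ν
  have hM := one_le_enorm2Z d hτ
  have hN0 := enorm2Z_nonneg d ν
  have hN : enorm2Z d ν ≤ enorm2Z d ν ^ 2 := by
    rcases eq_or_ne ν 0 with rfl | hν
    · simp [enorm2Z]
    · nlinarith [one_le_enorm2Z d hν]
  set N := enorm2Z d ν
  set M := enorm2Z d τ
  set D := dotZR d τ ν
  have hπ : (3 : ℝ) ≤ 4 * Real.pi ^ 2 := by nlinarith [Real.pi_gt_three]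
  have hD' : D ^ 2 ≤ N ^ 2 * M := by nlinarith
  have hDle : D ≤ N * M := by
    refine le_of_sq_le_sq ?_ (by positivity)
    nlinarith [mul_nonneg (sq_nonneg N) (mul_nonneg (by linarith : (0 : ℝ) ≤ M)
      (by linarith : (0 : ℝ) ≤ M - 1))]
  refine abs_le_of_sq_le_sq ?_ (by positivity)
  rw [mul_pow, Real.sq_sqrt (by positivity)]
  have h1 : N ^ 2 * (3 * M) ≤ N ^ 2 * (4 * Real.pi ^ 2 * M) := by gcongr
  nlinarith [mul_le_mul_of_nonneg_left hDle hN0]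

theorem sum_sqrt_mul_le {ι : Type*} (s : Finset ι) (w b : ι → ℝ) (hw : ∀ i, 0 ≤ w i) :
    ∑ i ∈ s, √(w i) * b i ≤ √(#s) * √(∑ i ∈ s, w i * b i ^ 2) := by
  rw [← Real.sqrt_mul (Nat.cast_nonneg _)]
  refine Real.le_sqrt_of_sq_le (sq_sum_le_card_mul_sum_sq.trans_eq ?_)
  simp_rw [mul_pow, Real.sq_sqrt (hw _)]


theorem stmt7 (d : ℕ) (hd : 1 ≤ d)
    (T : Finset (Fin d → ℤ)) (hT0 : (0 : Fin d → ℤ) ∉ T) (hTsym : ∀ τ ∈ T, -τ ∈ T)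
    (a₀ ρ : ℝ) (ha₀ : 0 < a₀) (hρ : 0 < ρ)
    (aC : (Fin d → ℤ) → ℂ) (haSym : ∀ τ ∈ T, aC (-τ) = (starRingEnd ℂ) (aC τ))
    (a : (Fin d → ℝ) → ℂ) (ha : a = fun x => (a₀ : ℂ) + ∑ τ ∈ T, aC τ * fourF d τ x)
    (r : (Fin d → ℤ) → ℝ)
    (hr : r = fun ν => 1 / (4 * Real.pi ^ 2 * enorm2Z d ν + ρ / a₀))
    (Ψ : (Fin d → ℤ) → (Fin d → ℝ) → ℂ)
    (hΨ : Ψ = fun ν x => (r ν : ℂ) * fourF d ν x)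
    (β : ℝ)
    (hβ : β = Real.sqrt T.card *
      Real.sqrt ((a₀ ^ 2 + ∑ τ ∈ T, (1 + 4 * Real.pi ^ 2 * enorm2Z d τ) * ‖aC τ‖ ^ 2) - a₀ ^ 2)) :
    ∀ ν : Fin d → ℤ, ∀ x ∈ Set.Icc (0 : Fin d → ℝ) 1,
      ‖Lop d a ρ (Ψ ν) x‖ ≤ a₀ + β + ρ / (4 * Real.pi ^ 2) := by
  intro ν x _
  subst ha hr hΨ hβ
  have hN := enorm2Z_nonneg d ν
  have hden : 0 < 4 * Real.pi ^ 2 * enorm2Z d ν + ρ / a₀ := by positivity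
  set r := 1 / (4 * Real.pi ^ 2 * enorm2Z d ν + ρ / a₀) with hr
  have hr0 : 0 ≤ r := by positivity
  have hra : r * (4 * Real.pi ^ 2 * enorm2Z d ν * a₀ + ρ) = a₀ := by
    rw [hr]
    field_simp
  have hrN : r * (4 * Real.pi ^ 2 * enorm2Z d ν) ≤ 1 := by
    rw [hr, one_div_mul_eq_div, div_le_one hden]
    linarith [div_pos hρ ha₀]
  have hterm : ∀ τ ∈ T, ‖(r : ℂ) * (4 * (Real.pi : ℂ) ^ 2 *
      ((enorm2Z d ν + dotZR d τ ν : ℝ) : ℂ) * aC τ * fourF d (τ + ν) x)‖ ≤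
      √(1 + 4 * Real.pi ^ 2 * enorm2Z d τ) * ‖aC τ‖ := by
    intro τ hτ
    have h := abs_enorm2Z_add_dotZR_le d (ne_of_mem_of_not_mem hτ hT0) ν
    simp only [norm_mul, norm_pow, norm_fourF, Complex.norm_real, Real.norm_eq_abs,
      abs_of_nonneg hr0, abs_of_pos Real.pi_pos, Complex.norm_ofNat, mul_one]
    calc r * (4 * Real.pi ^ 2 * |enorm2Z d ν + dotZR d τ ν| * ‖aC τ‖)
        ≤ r * (4 * Real.pi ^ 2 *
            (enorm2Z d ν * √(1 + 4 * Real.pi ^ 2 * enorm2Z d τ)) * ‖aC τ‖) := by gcongr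
      _ = r * (4 * Real.pi ^ 2 * enorm2Z d ν) *
            (√(1 + 4 * Real.pi ^ 2 * enorm2Z d τ) * ‖aC τ‖) := by ring
      _ ≤ _ := mul_le_of_le_one_left (by positivity) hrN
  have hmain : (r : ℂ) * ((4 * (Real.pi : ℂ) ^ 2 * (enorm2Z d ν : ℂ) * a₀ + ρ) * fourF d ν x) =
      (a₀ : ℂ) * fourF d ν x := by
    rw [← mul_assoc]
    congr 1
    exact_mod_cast hra
  have hcs := sum_sqrt_mul_le T (fun τ => 1 + 4 * Real.pi ^ 2 * enorm2Z d τ) (fun τ => ‖aC τ‖)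
    fun τ => by have := enorm2Z_nonneg d τ; positivity
  have hρπ : 0 ≤ ρ / (4 * Real.pi ^ 2) := by positivity
  rw [Lop_const_mul_fourF, mul_add, hmain, Finset.mul_sum, add_sub_cancel_left]
  refine (norm_add_le _ _).trans ?_
  have h0 : ‖(a₀ : ℂ) * fourF d ν x‖ = a₀ := by
    rw [norm_mul, norm_fourF, mul_one, Complex.norm_real, Real.norm_of_nonneg ha₀.le]
  linarith [norm_sum_le_of_le T hterm]
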